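/- For every K ∈ 𝕂 and every tuple E = (E_1,…,E_N) of real k×d matrices, the second directional derivative of the cost satisfies (d²/dt²)|_{t=0} C(K + tE) = 2⟨(R + BᵀE(P^K)B) E 𝐗^K, E⟩ − 4⟨BᵀE((P^K)'[E]) Γ 𝐗^K, E⟩, i.e., equals 2∑_{i=1}^N tr(𝐗^K_i E_iᵀ (R_i + B_iᵀE_i(P^K)B_i) E_i) − 4∑_{i=1}^N tr(𝐗^K_i E_iᵀ B_iᵀ E_i((P^K)'[E]) Γ_i), where (P^K)'[E] = ∑_{t=0}^∞ L^t(Eᵀ L^K + (L^K)ᵀ E) and L is the operator with components L_i(V) = Γ_iᵀ E_i(V) Γ_i. -/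

import Mathlib

open Matrix Filter
open scoped Kronecker Topology

namespace MJLS

noncomputable section

attribute [local instance] Classical.propDecidable

/-- Closed-loop matrices `Γ i = A i - B i * K i`. -/
def Gam {d k N : ℕ} (A : Fin N → Matrix (Fin d) (Fin d) ℝ)
    (B : Fin N → Matrix (Fin d) (Fin k) ℝ)
    (K : Fin N → Matrix (Fin k) (Fin d) ℝ) : Fin N → Matrix (Fin d) (Fin d) ℝ :=
  fun i => A i - B i * K i

/-- The operator `E_i(V) = ∑ j, p i j • V j`. -/
def opE {d N : ℕ} (Pr : Matrix (Fin N) (Fin N) ℝ)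
    (V : Fin N → Matrix (Fin d) (Fin d) ℝ) : Fin N → Matrix (Fin d) (Fin d) ℝ :=
  fun i => ∑ j, Pr i j • V j

/-- The matrix `𝒜 = diag(Γᵀ ⊗ Γᵀ) (P ⊗ I)`. -/
def calA {d N : ℕ} (Pr : Matrix (Fin N) (Fin N) ℝ)
    (Γ : Fin N → Matrix (Fin d) (Fin d) ℝ) :
    Matrix (Fin N × Fin d × Fin d) (Fin N × Fin d × Fin d) ℝ :=
  (Matrix.reindex (Equiv.prodComm (Fin d × Fin d) (Fin N))
      (Equiv.prodComm (Fin d × Fin d) (Fin N))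
      (Matrix.blockDiagonal fun i => (Γ i)ᵀ ⊗ₖ (Γ i)ᵀ)) *
    (Pr ⊗ₖ (1 : Matrix (Fin d × Fin d) (Fin d × Fin d) ℝ))

/-- `K` is mean-square stabilizing: the spectral radius of `𝒜` is less than `1`. -/
def MSS {d k N : ℕ} (Pr : Matrix (Fin N) (Fin N) ℝ)
    (A : Fin N → Matrix (Fin d) (Fin d) ℝ) (B : Fin N → Matrix (Fin d) (Fin k) ℝ)
    (K : Fin N → Matrix (Fin k) (Fin d) ℝ) : Prop :=
  spectralRadius ℂ ((calA Pr (Gam A B K)).map (algebraMap ℝ ℂ)) < 1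

/-- `P` solves the coupled Lyapunov equations for the policy `K`. -/
def IsLyap {d k N : ℕ} (Pr : Matrix (Fin N) (Fin N) ℝ)
    (A : Fin N → Matrix (Fin d) (Fin d) ℝ) (B : Fin N → Matrix (Fin d) (Fin k) ℝ)
    (Q : Fin N → Matrix (Fin d) (Fin d) ℝ) (R : Fin N → Matrix (Fin k) (Fin k) ℝ)
    (K : Fin N → Matrix (Fin k) (Fin d) ℝ)
    (P : Fin N → Matrix (Fin d) (Fin d) ℝ) : Prop :=
  ∀ i, P i = Q i + (K i)ᵀ * R i * K i + (Gam A B K i)ᵀ * opE Pr P i * Gam A B K i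

/-- `P^K`, the (for mean-square stabilizing `K`, unique) solution of the coupled
Lyapunov equations. -/
def PK {d k N : ℕ} (Pr : Matrix (Fin N) (Fin N) ℝ)
    (A : Fin N → Matrix (Fin d) (Fin d) ℝ) (B : Fin N → Matrix (Fin d) (Fin k) ℝ)
    (Q : Fin N → Matrix (Fin d) (Fin d) ℝ) (R : Fin N → Matrix (Fin k) (Fin k) ℝ)
    (K : Fin N → Matrix (Fin k) (Fin d) ℝ) : Fin N → Matrix (Fin d) (Fin d) ℝ :=
  if h : ∃ P, IsLyap Pr A B Q R K P then h.choose else 0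

/-- The LQR cost `C(K) = ∑ i, π i * tr(P^K_i Sg)`. -/
def cost {d k N : ℕ} (Pr : Matrix (Fin N) (Fin N) ℝ)
    (A : Fin N → Matrix (Fin d) (Fin d) ℝ) (B : Fin N → Matrix (Fin d) (Fin k) ℝ)
    (Q : Fin N → Matrix (Fin d) (Fin d) ℝ) (R : Fin N → Matrix (Fin k) (Fin k) ℝ)
    (piv : Fin N → ℝ) (Sg : Matrix (Fin d) (Fin d) ℝ)
    (K : Fin N → Matrix (Fin k) (Fin d) ℝ) : ℝ :=
  ∑ i, piv i * (PK Pr A B Q R K i * Sg).trace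

/-- The operator `T_j(V) = ∑ i, p i j • (Γ i * V i * Γ iᵀ)`. -/
def opT {d N : ℕ} (Pr : Matrix (Fin N) (Fin N) ℝ)
    (Γ : Fin N → Matrix (Fin d) (Fin d) ℝ)
    (V : Fin N → Matrix (Fin d) (Fin d) ℝ) : Fin N → Matrix (Fin d) (Fin d) ℝ :=
  fun j => ∑ i, Pr i j • (Γ i * V i * (Γ i)ᵀ)

/-- `𝐗^K = ∑_{t=0}^∞ T^t(X(0))` with `X_i(0) = π i • Sg`. -/
def XK {d N : ℕ} (Pr : Matrix (Fin N) (Fin N) ℝ) (piv : Fin N → ℝ)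
    (Sg : Matrix (Fin d) (Fin d) ℝ) (Γ : Fin N → Matrix (Fin d) (Fin d) ℝ) :
    Fin N → Matrix (Fin d) (Fin d) ℝ :=
  ∑' t : ℕ, (opT Pr Γ)^[t] (fun i => piv i • Sg)

/-- `L^K_i = (R i + B iᵀ E_i(P^K) B i) K i - B iᵀ E_i(P^K) A i`. -/
def LK {d k N : ℕ} (Pr : Matrix (Fin N) (Fin N) ℝ)
    (A : Fin N → Matrix (Fin d) (Fin d) ℝ) (B : Fin N → Matrix (Fin d) (Fin k) ℝ)
    (Q : Fin N → Matrix (Fin d) (Fin d) ℝ) (R : Fin N → Matrix (Fin k) (Fin k) ℝ)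
    (K : Fin N → Matrix (Fin k) (Fin d) ℝ) : Fin N → Matrix (Fin k) (Fin d) ℝ :=
  fun i => (R i + (B i)ᵀ * opE Pr (PK Pr A B Q R K) i * B i) * K i
    - (B i)ᵀ * opE Pr (PK Pr A B Q R K) i * A i

/-- The operator `L_i(V) = Γ iᵀ E_i(V) Γ i`. -/
def opL {d N : ℕ} (Pr : Matrix (Fin N) (Fin N) ℝ)
    (Γ : Fin N → Matrix (Fin d) (Fin d) ℝ)
    (V : Fin N → Matrix (Fin d) (Fin d) ℝ) : Fin N → Matrix (Fin d) (Fin d) ℝ :=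
  fun i => (Γ i)ᵀ * opE Pr V i * Γ i

/-- `(P^K)'[E] = ∑_{t=0}^∞ L^t(Eᵀ L^K + (L^K)ᵀ E)`. -/
def PKd {d k N : ℕ} (Pr : Matrix (Fin N) (Fin N) ℝ)
    (Γ : Fin N → Matrix (Fin d) (Fin d) ℝ)
    (Lk E : Fin N → Matrix (Fin k) (Fin d) ℝ) : Fin N → Matrix (Fin d) (Fin d) ℝ :=
  ∑' t : ℕ, (opL Pr Γ)^[t] (fun i => (E i)ᵀ * Lk i + (Lk i)ᵀ * E i)

/-- `‖V‖₂² = ∑ i, tr(V iᵀ V i)`. -/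
def norm2sq {a b N : ℕ} (V : Fin N → Matrix (Fin a) (Fin b) ℝ) : ℝ :=
  ∑ i, ((V i)ᵀ * V i).trace

/-- The inner product `⟨V, S⟩ = ∑ i, tr(V iᵀ S i)`. -/
def ip {a b N : ℕ} (V S : Fin N → Matrix (Fin a) (Fin b) ℝ) : ℝ :=
  ∑ i, ((V i)ᵀ * S i).trace

/-- The spectral norm (maximal singular value) of a matrix. -/
def specNorm {a b : ℕ} (M : Matrix (Fin a) (Fin b) ℝ) : ℝ :=
  ⨆ x : {x : EuclideanSpace ℝ (Fin b) // ‖x‖ ≤ 1}, ‖Matrix.toEuclideanLin M x.1‖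

/-- The minimal singular value of a square matrix. -/
def sigmaMin {a : ℕ} (M : Matrix (Fin a) (Fin a) ℝ) : ℝ :=
  ⨅ x : {x : EuclideanSpace ℝ (Fin a) // ‖x‖ = 1}, ‖Matrix.toEuclideanLin M x.1‖

/-- `‖V‖_max = max_i ‖V i‖` (spectral norms). -/
def maxNorm {a b N : ℕ} (V : Fin N → Matrix (Fin a) (Fin b) ℝ) : ℝ :=
  ⨆ i, specNorm (V i)

/-- `Λ_min(V) = min_i σ_min(V i)`. -/
def lamMin {a N : ℕ} (V : Fin N → Matrix (Fin a) (Fin a) ℝ) : ℝ :=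
  ⨅ i, sigmaMin (V i)

/-- `μ = (min_i π i) · σ_min(Sg)`. -/
def mu {d N : ℕ} (piv : Fin N → ℝ) (Sg : Matrix (Fin d) (Fin d) ℝ) : ℝ :=
  (⨅ i, piv i) * sigmaMin Sg

/-- `ξ(α) = (1/Λ_min(Q))·((1 + ‖B‖²_max)·α/μ + ‖R‖_max) − 1`. -/
def xi {d k N : ℕ} (B : Fin N → Matrix (Fin d) (Fin k) ℝ)
    (R : Fin N → Matrix (Fin k) (Fin k) ℝ) (Q : Fin N → Matrix (Fin d) (Fin d) ℝ)
    (piv : Fin N → ℝ) (Sg : Matrix (Fin d) (Fin d) ℝ) (α : ℝ) : ℝ :=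
  (1 / lamMin Q) * ((1 + maxNorm B ^ 2) * α / mu piv Sg + maxNorm R) - 1

/-- The smoothness constant
`L(α) = 2·(‖R‖_max + ‖B‖²_max·(1 + 2ξ(α)/‖B‖_max)·α/μ)·α/Λ_min(Q)`. -/
def Lsm {d k N : ℕ} (B : Fin N → Matrix (Fin d) (Fin k) ℝ)
    (R : Fin N → Matrix (Fin k) (Fin k) ℝ) (Q : Fin N → Matrix (Fin d) (Fin d) ℝ)
    (piv : Fin N → ℝ) (Sg : Matrix (Fin d) (Fin d) ℝ) (α : ℝ) : ℝ :=
  2 * (maxNorm R + maxNorm B ^ 2 * (1 + 2 * xi B R Q piv Sg α / maxNorm B)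
      * α / mu piv Sg) * α / lamMin Q

end


lemma abstract_second {V : Type*} [NormedAddCommGroup V] [NormedSpace ℝ V] [CompleteSpace V]
    (L0 L1 L2 : V →L[ℝ] V) (W0 W1 W2 : V) (φ : V →L[ℝ] ℝ) (p : ℝ → V)
    (hu : Function.Bijective ⇑(1 - L0))
    (hp : ∀ t : ℝ, Function.Bijective ⇑(1 - (L0 + t • L1 + t ^ 2 • L2)) →
      p t = (W0 + t • W1 + t ^ 2 • W2) + (L0 + t • L1 + t ^ 2 • L2) (p t)) :
    ∃ p1 p2 : V, p1 = W1 + L1 (p 0) + L0 p1 ∧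
      p2 = (2 : ℝ) • W2 + (2 : ℝ) • L2 (p 0) + (2 : ℝ) • L1 p1 + L0 p2 ∧
      deriv (deriv fun t => φ (p t)) 0 = φ p2 := by
  simp only [← ContinuousLinearMap.isUnit_iff_bijective] at hu hp
  set L : ℝ → (V →L[ℝ] V) := fun t => L0 + t • L1 + t ^ 2 • L2 with hL
  set W : ℝ → V := fun t => W0 + t • W1 + t ^ 2 • W2 with hW
  have hLc : ContDiff ℝ 2 L := by fun_prop
  have hWc : ContDiff ℝ 2 W := by fun_prop
  have hL0 : L 0 = L0 := by simp [hL]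
  have hu0 : IsUnit (1 - L 0) := by rwa [hL0]
  have hev : ∀ᶠ t in 𝓝 (0:ℝ), IsUnit (1 - L t) := by
    have hc : ContinuousAt (fun t => 1 - L t) 0 := (continuous_const.sub hLc.continuous).continuousAt
    exact hc.eventually (Units.isOpen.mem_nhds hu0)
  have heq : ∀ᶠ t in 𝓝 (0:ℝ), p t = W t + L t (p t) := hev.mono fun t ht => hp t ht
  have hpg : p =ᶠ[𝓝 0] fun t => (Ring.inverse (1 - L t)) (W t) := by
    filter_upwards [hev] with t ht
    have h1 : (1 - L t) (p t) = W t := by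
      have := hp t ht
      rw [_root_.sub_apply, one_apply_eq_self, sub_eq_iff_eq_add]
      exact this
    rw [← h1, ← mul_apply_eq_comp, Ring.inverse_mul_cancel _ ht]
    rfl
  have hinv : ContDiffAt ℝ 2 (fun t => Ring.inverse (1 - L t)) 0 := by
    obtain ⟨u, hu'⟩ := hu0
    have h1 : ContDiffAt ℝ 2 (Ring.inverse : (V →L[ℝ] V) → _) (1 - L 0) := by
      rw [← hu']; exact contDiffAt_ringInverse ℝ u
    exact h1.comp (0:ℝ) (f := fun t => 1 - L t) (contDiff_const.sub hLc).contDiffAt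
  have hpc : ContDiffAt ℝ 2 p 0 :=
    (hinv.clm_apply hWc.contDiffAt).congr_of_eventuallyEq hpg
  have hpd : ∀ᶠ t in 𝓝 (0:ℝ), HasDerivAt p (deriv p t) t := by
    have := hpc.eventually (by simp)
    exact this.mono fun t ht => (ht.differentiableAt (by norm_num)).hasDerivAt
  have hpd2 : HasDerivAt (deriv p) (deriv (deriv p) 0) 0 := by
    have : ContDiffAt ℝ 1 (deriv p) 0 := by
      have h := (hpc.fderiv_right (m := 1) (by norm_num)).clm_apply (contDiffAt_const (c := (1:ℝ)))
      simpa using h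
    exact (this.differentiableAt (by norm_num)).hasDerivAt
  have hLd : ∀ t, HasDerivAt L (L1 + (2 * t) • L2) t := by
    intro t
    have h := (((hasDerivAt_id t).smul_const L1).const_add L0).add
      (((hasDerivAt_id t).pow 2).smul_const L2)
    refine (h.congr_deriv ?_)
    simp
  have hWd : ∀ t, HasDerivAt W (W1 + (2 * t) • W2) t := by
    intro t
    have h := (((hasDerivAt_id t).smul_const W1).const_add W0).add
      (((hasDerivAt_id t).pow 2).smul_const W2)
    refine (h.congr_deriv ?_)
    simp
  have heq1 : ∀ᶠ t in 𝓝 (0:ℝ), deriv p t = (W1 + (2 * t) • W2) +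
      ((L1 + (2 * t) • L2) (p t) + L t (deriv p t)) := by
    filter_upwards [heq.eventually_nhds, hpd] with t ht hd
    have h := (hWd t).add ((hLd t).clm_apply hd)
    exact (h.congr_of_eventuallyEq ht).deriv
  have hL1d : HasDerivAt (fun t : ℝ => L1 + (2 * t) • L2) ((2:ℝ) • L2) 0 := by
    have h := ((((hasDerivAt_id (0:ℝ)).const_mul 2).smul_const L2).const_add L1)
    simpa using h
  have hW1d : HasDerivAt (fun t : ℝ => W1 + (2 * t) • W2) ((2:ℝ) • W2) 0 := by
    have h := ((((hasDerivAt_id (0:ℝ)).const_mul 2).smul_const W2).const_add W1)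
    simpa using h
  have heq2 := ((hW1d.add ((hL1d.clm_apply hpd.self_of_nhds).add
    ((hLd 0).clm_apply hpd2))).congr_of_eventuallyEq heq1).deriv
  refine ⟨deriv p 0, deriv (deriv p) 0, ?_, ?_, ?_⟩
  · have := heq1.self_of_nhds
    simp only [hL0, mul_zero, zero_smul, add_zero] at this
    rw [add_assoc]; exact this
  · simp only [hL0, mul_zero, zero_smul, add_zero] at heq2
    refine heq2.trans ?_
    rw [show ((2:ℝ) • L2) (p 0) = (2:ℝ) • L2 (p 0) from rfl]
    simp only [two_smul]
    abel
  · have h1 : (deriv fun t => φ (p t)) =ᶠ[𝓝 0] fun t => φ (deriv p t) := by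
      filter_upwards [hpd] with t ht
      exact (φ.hasFDerivAt.comp_hasDerivAt t ht).deriv
    rw [h1.deriv_eq]
    exact (φ.hasFDerivAt.comp_hasDerivAt (0:ℝ) hpd2).deriv

section
attribute [local instance] Matrix.linftyOpNormedRing Matrix.linftyOpNormedAlgebra

lemma summable_pow_entries {n : Type*} [Fintype n] [DecidableEq n] (M : Matrix n n ℝ)
    (h : spectralRadius ℂ (M.map (algebraMap ℝ ℂ)) < 1) (a b : n) :
    Summable fun t : ℕ => (M ^ t) a b := by
  set C := M.map (algebraMap ℝ ℂ) with hC
  have hpow : ∀ t, C ^ t = (M ^ t).map (algebraMap ℝ ℂ) := by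
    intro t
    exact (map_pow (algebraMap ℝ ℂ).mapMatrix M t).symm
  have hG := spectrum.pow_nnnorm_pow_one_div_tendsto_nhds_spectralRadius C
  obtain ⟨r, hr1, hr2⟩ := ENNReal.lt_iff_exists_nnreal_btwn.1 h
  have hr2' : r < 1 := by exact_mod_cast hr2
  have hev := hG.eventually (gt_mem_nhds hr1)
  have hb : ∀ᶠ t : ℕ in atTop, ‖(M ^ t) a b‖ ≤ (r : ℝ) ^ t := by
    filter_upwards [hev, eventually_gt_atTop 0] with t ht ht0
    have h1 : (‖C ^ t‖₊ : ENNReal) < (r : ENNReal) ^ t := by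
      have := ENNReal.rpow_lt_rpow ht (z := (t:ℝ)) (by exact_mod_cast ht0)
      rw [← ENNReal.rpow_mul, one_div_mul_cancel (by positivity), ENNReal.rpow_one,
        ENNReal.rpow_natCast] at this
      exact this
    have h2 : ‖C ^ t‖₊ < r ^ t := by exact_mod_cast h1
    have h3 : ‖(C ^ t) a b‖₊ ≤ ‖C ^ t‖₊ := by
      rw [Matrix.linfty_opNNNorm_def]
      refine le_trans ?_ (Finset.le_sup (f := fun i => ∑ j, ‖(C ^ t) i j‖₊) (Finset.mem_univ a))
      exact Finset.single_le_sum (f := fun j => ‖(C ^ t) a j‖₊) (fun _ _ => zero_le) (Finset.mem_univ b)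
    have h4 : ‖(C ^ t) a b‖ = ‖(M ^ t) a b‖ := by
      rw [hpow, Matrix.map_apply]; simp
    rw [← h4]
    have : ‖(C ^ t) a b‖₊ ≤ r ^ t := h3.trans h2.le
    exact_mod_cast this
  exact Summable.of_norm_bounded_eventually_nat
    (summable_geometric_of_lt_one r.2 hr2') hb
end


lemma opE_add {d N : ℕ} (Pr : Matrix (Fin N) (Fin N) ℝ) (V W : Fin N → Matrix (Fin d) (Fin d) ℝ)
    (i : Fin N) : opE Pr (V + W) i = opE Pr V i + opE Pr W i := by
  simp [opE, Finset.sum_add_distrib]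

lemma opE_smul {d N : ℕ} (Pr : Matrix (Fin N) (Fin N) ℝ) (c : ℝ)
    (V : Fin N → Matrix (Fin d) (Fin d) ℝ)
    (i : Fin N) : opE Pr (c • V) i = c • opE Pr V i := by
  simp [opE, Finset.smul_sum, smul_comm c]

lemma opE_transpose {d N : ℕ} (Pr : Matrix (Fin N) (Fin N) ℝ)
    (V : Fin N → Matrix (Fin d) (Fin d) ℝ)
    (i : Fin N) : (opE Pr V i)ᵀ = opE Pr (fun i => (V i)ᵀ) i := by
  simp [opE, Matrix.transpose_sum, Matrix.transpose_smul]

/-- The sandwich operator `V ↦ Γᵀ E(V) Δ`. -/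
def opLL {d N : ℕ} (Pr : Matrix (Fin N) (Fin N) ℝ) (Γ Δ : Fin N → Matrix (Fin d) (Fin d) ℝ) :
    (Fin N → Matrix (Fin d) (Fin d) ℝ) →ₗ[ℝ] (Fin N → Matrix (Fin d) (Fin d) ℝ) where
  toFun V := fun i => (Γ i)ᵀ * opE Pr V i * Δ i
  map_add' V W := by
    funext i
    simp [opE_add, Matrix.mul_add, Matrix.add_mul]
  map_smul' c V := by
    funext i
    simp [opE_smul]

lemma opLL_apply {d N : ℕ} (Pr : Matrix (Fin N) (Fin N) ℝ)
    (Γ Δ V : Fin N → Matrix (Fin d) (Fin d) ℝ) (i : Fin N) :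
    opLL Pr Γ Δ V i = (Γ i)ᵀ * opE Pr V i * Δ i := rfl

lemma opL_eq {d N : ℕ} (Pr : Matrix (Fin N) (Fin N) ℝ) (Γ : Fin N → Matrix (Fin d) (Fin d) ℝ) :
    opL Pr Γ = opLL Pr Γ Γ := rfl

/-- `opT` as a linear map. -/
def opTl {d N : ℕ} (Pr : Matrix (Fin N) (Fin N) ℝ) (Γ : Fin N → Matrix (Fin d) (Fin d) ℝ) :
    (Fin N → Matrix (Fin d) (Fin d) ℝ) →ₗ[ℝ] (Fin N → Matrix (Fin d) (Fin d) ℝ) where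
  toFun V := opT Pr Γ V
  map_add' V W := by
    funext i
    simp [opT, Matrix.mul_add, Matrix.add_mul, Finset.sum_add_distrib]
  map_smul' c V := by
    funext i
    simp [opT, Finset.smul_sum, smul_comm c]

lemma calA_mulVec {d N : ℕ} (Pr : Matrix (Fin N) (Fin N) ℝ)
    (Γ : Fin N → Matrix (Fin d) (Fin d) ℝ) (V : Fin N → Matrix (Fin d) (Fin d) ℝ) :
    calA Pr Γ *ᵥ (fun x => V x.1 x.2.1 x.2.2) = fun x => opL Pr Γ V x.1 x.2.1 x.2.2 := by
  have h1 : (Pr ⊗ₖ (1 : Matrix (Fin d × Fin d) (Fin d × Fin d) ℝ)) *ᵥ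
      (fun x => V x.1 x.2.1 x.2.2) = fun x => opE Pr V x.1 x.2.1 x.2.2 := by
    funext x
    obtain ⟨i, a, b⟩ := x
    simp only [Matrix.mulVec, dotProduct, Fintype.sum_prod_type, Matrix.kroneckerMap_apply,
      Matrix.one_apply, opE, Matrix.sum_apply, Matrix.smul_apply, smul_eq_mul]
    refine Finset.sum_congr rfl fun j _ => ?_
    rw [Finset.sum_eq_single a, Finset.sum_eq_single b]
    · simp
    · intro c _ hc; simp [hc.symm]
    · simp
    · intro c _ hc; simp [hc.symm]
    · simp
  rw [calA, ← Matrix.mulVec_mulVec, h1]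
  funext x
  obtain ⟨i, a, b⟩ := x
  simp only [Matrix.mulVec, dotProduct, Fintype.sum_prod_type, Matrix.reindex_apply,
    Matrix.submatrix_apply, opL, Equiv.prodComm_symm, Equiv.prodComm_apply, Prod.swap_prod_mk,
    Matrix.blockDiagonal_apply, Matrix.kroneckerMap_apply, Matrix.mul_apply, Matrix.transpose_apply]
  rw [Finset.sum_eq_single i]
  · rw [Finset.sum_comm]
    refine Finset.sum_congr rfl fun c _ => ?_
    rw [Finset.sum_mul]
    refine Finset.sum_congr rfl fun e _ => ?_
    simp; ring
  · intro c _ hc; simp [hc.symm]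
  · simp

lemma summable_opL {d N : ℕ} (Pr : Matrix (Fin N) (Fin N) ℝ)
    (Γ : Fin N → Matrix (Fin d) (Fin d) ℝ)
    (h : spectralRadius ℂ ((calA Pr Γ).map (algebraMap ℝ ℂ)) < 1)
    (V : Fin N → Matrix (Fin d) (Fin d) ℝ) :
    Summable fun t : ℕ => (opL Pr Γ)^[t] V := by
  have key : ∀ t : ℕ, (calA Pr Γ ^ t) *ᵥ (fun x => V x.1 x.2.1 x.2.2)
      = fun x => ((opL Pr Γ)^[t] V) x.1 x.2.1 x.2.2 := by
    intro t
    induction t with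
    | zero => simp
    | succ t ih =>
      rw [pow_succ', ← Matrix.mulVec_mulVec, ih, calA_mulVec, Function.iterate_succ_apply']
  refine Pi.summable.2 fun i => Pi.summable.2 fun a => Pi.summable.2 fun b => ?_
  have : ∀ t : ℕ, ((opL Pr Γ)^[t] V) i a b
      = ∑ y, (calA Pr Γ ^ t) (i, a, b) y * V y.1 y.2.1 y.2.2 := by
    intro t
    exact (congrFun (key t) (i, a, b)).symm
  simp only [this]
  exact summable_sum fun y _ => (summable_pow_entries _ h _ _).mul_right _

lemma ip_adj {d N : ℕ} (Pr : Matrix (Fin N) (Fin N) ℝ)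
    (Γ : Fin N → Matrix (Fin d) (Fin d) ℝ) (V X : Fin N → Matrix (Fin d) (Fin d) ℝ) :
    ∑ i, (opL Pr Γ V i * X i).trace = ∑ i, (V i * opT Pr Γ X i).trace := by
  simp only [opL, opE, opT, Matrix.mul_sum, Matrix.sum_mul, Matrix.trace_sum, Matrix.mul_smul,
    Matrix.smul_mul, Matrix.trace_smul]
  rw [Finset.sum_comm]
  refine Finset.sum_congr rfl fun i _ => Finset.sum_congr rfl fun j _ => ?_
  congr 1
  rw [Matrix.mul_assoc, Matrix.mul_assoc, Matrix.trace_mul_comm, Matrix.mul_assoc]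

lemma ip_adj_iter {d N : ℕ} (Pr : Matrix (Fin N) (Fin N) ℝ)
    (Γ : Fin N → Matrix (Fin d) (Fin d) ℝ) (t : ℕ) (V X : Fin N → Matrix (Fin d) (Fin d) ℝ) :
    ∑ i, ((opL Pr Γ)^[t] V i * X i).trace = ∑ i, (V i * (opT Pr Γ)^[t] X i).trace := by
  induction t generalizing V with
  | zero => rfl
  | succ t ih =>
    rw [Function.iterate_succ_apply, ih, ip_adj, Function.iterate_succ_apply']

lemma summable_opT {d N : ℕ} (Pr : Matrix (Fin N) (Fin N) ℝ)
    (Γ : Fin N → Matrix (Fin d) (Fin d) ℝ)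
    (h : spectralRadius ℂ ((calA Pr Γ).map (algebraMap ℝ ℂ)) < 1)
    (X : Fin N → Matrix (Fin d) (Fin d) ℝ) :
    Summable fun t : ℕ => (opT Pr Γ)^[t] X := by
  refine Pi.summable.2 fun i => Pi.summable.2 fun a => Pi.summable.2 fun b => ?_
  have hs := summable_opL Pr Γ h (Pi.single i (Matrix.single b a 1))
  have h2 : ∀ t : ℕ, ((opT Pr Γ)^[t] X) i a b =
      ∑ j, ((opL Pr Γ)^[t] (Pi.single i (Matrix.single b a 1)) j * X j).trace := by
    intro t
    rw [ip_adj_iter, Finset.sum_eq_single i]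
    · simp [Matrix.trace_single_mul]
    · intro j _ hj; simp [hj]
    · simp
  simp only [h2, Matrix.trace, Matrix.diag, Matrix.mul_apply]
  refine summable_sum fun j _ => summable_sum fun c _ => summable_sum fun e _ => ?_
  exact (Pi.summable.1 (Pi.summable.1 (Pi.summable.1 hs j) c) e).mul_right _

/-- Fixed point equation of the Neumann series and uniqueness. -/
lemma neumann_fix {V : Type*} [AddCommGroup V] [Module ℝ V] [TopologicalSpace V]
    [IsTopologicalAddGroup V] [T2Space V] (T : V →ₗ[ℝ] V) (hc : Continuous T)
    (hs : ∀ v, Summable fun t : ℕ => (T)^[t] v) (u : V) :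
    ∑' t : ℕ, T^[t] u = u + T (∑' t : ℕ, T^[t] u) := by
  rw [(hs u).map_tsum T hc, (hs u).tsum_eq_zero_add]
  simp [Function.iterate_succ_apply']

lemma neumann_inj {V : Type*} [AddCommGroup V] [Module ℝ V] [TopologicalSpace V]
    [IsTopologicalAddGroup V] [T2Space V] (T : V →ₗ[ℝ] V)
    (hs : ∀ v, Summable fun t : ℕ => (T)^[t] v) (v : V) (hv : v = T v) : v = 0 := by
  have h1 : ∀ t : ℕ, T^[t] v = v := fun t => Function.iterate_fixed hv.symm t
  have h := hs v
  simp only [h1] at h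
  exact tendsto_nhds_unique tendsto_const_nhds h.tendsto_atTop_zero

lemma neumann_unique {V : Type*} [AddCommGroup V] [Module ℝ V] [TopologicalSpace V]
    [IsTopologicalAddGroup V] [T2Space V] (T : V →ₗ[ℝ] V)
    (hs : ∀ v, Summable fun t : ℕ => (T)^[t] v) (u v w : V) (hv : v = u + T v)
    (hw : w = u + T w) : v = w := by
  refine sub_eq_zero.1 (neumann_inj T hs (v - w) ?_)
  rw [map_sub]
  nth_rewrite 1 [hv, hw]
  abel

lemma isLyap_iff {d k N : ℕ} (Pr : Matrix (Fin N) (Fin N) ℝ)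
    (A : Fin N → Matrix (Fin d) (Fin d) ℝ) (B : Fin N → Matrix (Fin d) (Fin k) ℝ)
    (Q : Fin N → Matrix (Fin d) (Fin d) ℝ) (R : Fin N → Matrix (Fin k) (Fin k) ℝ)
    (K : Fin N → Matrix (Fin k) (Fin d) ℝ) (P : Fin N → Matrix (Fin d) (Fin d) ℝ) :
    IsLyap Pr A B Q R K P ↔ P = (fun i => Q i + (K i)ᵀ * R i * K i)
      + opLL Pr (Gam A B K) (Gam A B K) P := funext_iff.symm

lemma opLL_expand {d k N : ℕ} (Pr : Matrix (Fin N) (Fin N) ℝ)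
    (A : Fin N → Matrix (Fin d) (Fin d) ℝ) (B : Fin N → Matrix (Fin d) (Fin k) ℝ)
    (K E : Fin N → Matrix (Fin k) (Fin d) ℝ) (t : ℝ) :
    opLL Pr (Gam A B (K + t • E)) (Gam A B (K + t • E)) =
      opLL Pr (Gam A B K) (Gam A B K)
      + t • -(opLL Pr (fun i => B i * E i) (Gam A B K)
          + opLL Pr (Gam A B K) (fun i => B i * E i))
      + t ^ 2 • opLL Pr (fun i => B i * E i) (fun i => B i * E i) := by
  refine LinearMap.ext fun V => funext fun i => ?_
  have h : Gam A B (K + t • E) i = Gam A B K i - t • (B i * E i) := by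
    simp [Gam, Matrix.mul_add, sub_sub]
  simp only [LinearMap.add_apply, LinearMap.smul_apply, LinearMap.neg_apply, Pi.add_apply,
    Pi.smul_apply, Pi.neg_apply, opLL_apply, h, Matrix.transpose_sub, Matrix.transpose_smul,
    Matrix.sub_mul, Matrix.mul_sub, Matrix.smul_mul, Matrix.mul_smul]
  module

lemma W_expand {d k N : ℕ}
    (Q : Fin N → Matrix (Fin d) (Fin d) ℝ) (R : Fin N → Matrix (Fin k) (Fin k) ℝ)
    (K E : Fin N → Matrix (Fin k) (Fin d) ℝ) (t : ℝ) :
    (fun i => Q i + ((K + t • E) i)ᵀ * R i * (K + t • E) i) =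
      (fun i => Q i + (K i)ᵀ * R i * K i)
      + t • (fun i => (E i)ᵀ * R i * K i + (K i)ᵀ * R i * E i)
      + t ^ 2 • (fun i => (E i)ᵀ * R i * E i) := by
  funext i
  simp only [Pi.add_apply, Pi.smul_apply, Matrix.transpose_add, Matrix.transpose_smul,
    Matrix.add_mul, Matrix.mul_add, Matrix.smul_mul, Matrix.mul_smul]
  module

lemma main_aux {d k N : ℕ} (Pr : Matrix (Fin N) (Fin N) ℝ)
    (A : Fin N → Matrix (Fin d) (Fin d) ℝ) (B : Fin N → Matrix (Fin d) (Fin k) ℝ)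
    (Q : Fin N → Matrix (Fin d) (Fin d) ℝ) (R : Fin N → Matrix (Fin k) (Fin k) ℝ)
    (piv : Fin N → ℝ) (Sg : Matrix (Fin d) (Fin d) ℝ)
    (K E : Fin N → Matrix (Fin k) (Fin d) ℝ)
    (hinj : ∀ V, V = opLL Pr (Gam A B K) (Gam A B K) V → V = 0) :
    IsLyap Pr A B Q R K (PK Pr A B Q R K) ∧
    ∃ P1 P2 : Fin N → Matrix (Fin d) (Fin d) ℝ,
      P1 = (fun i => (E i)ᵀ * R i * K i + (K i)ᵀ * R i * E i)
        + (-(opLL Pr (fun i => B i * E i) (Gam A B K)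
          + opLL Pr (Gam A B K) (fun i => B i * E i))) (PK Pr A B Q R K)
        + opLL Pr (Gam A B K) (Gam A B K) P1 ∧
      P2 = (2 : ℝ) • (fun i => (E i)ᵀ * R i * E i)
        + (2 : ℝ) • opLL Pr (fun i => B i * E i) (fun i => B i * E i) (PK Pr A B Q R K)
        + (2 : ℝ) • (-(opLL Pr (fun i => B i * E i) (Gam A B K)
          + opLL Pr (Gam A B K) (fun i => B i * E i))) P1
        + opLL Pr (Gam A B K) (Gam A B K) P2 ∧
      deriv (deriv fun t : ℝ => cost Pr A B Q R piv Sg (K + t • E)) 0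
        = ∑ i, piv i * (P2 i * Sg).trace := by
  let : NormedAddCommGroup (Matrix (Fin d) (Fin d) ℝ) := Matrix.normedAddCommGroup
  let : NormedSpace ℝ (Matrix (Fin d) (Fin d) ℝ) := Matrix.normedSpace
  have : CompleteSpace (Fin N → Matrix (Fin d) (Fin d) ℝ) := FiniteDimensional.complete ℝ _
  set L0 := opLL Pr (Gam A B K) (Gam A B K) with hL0
  set L1 := -(opLL Pr (fun i => B i * E i) (Gam A B K)
          + opLL Pr (Gam A B K) (fun i => B i * E i)) with hL1
  set L2 := opLL Pr (fun i => B i * E i) (fun i => B i * E i) with hL2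
  let φ : (Fin N → Matrix (Fin d) (Fin d) ℝ) →ₗ[ℝ] ℝ :=
    { toFun := fun P => ∑ i, piv i * (P i * Sg).trace
      map_add' := fun P P' => by
        simp [Matrix.add_mul, mul_add, Finset.sum_add_distrib]
      map_smul' := fun c P => by
        simp [Finset.mul_sum, mul_left_comm] }
  have hu : Function.Bijective ⇑(1 - LinearMap.toContinuousLinearMap L0) := by
    have hi : Function.Injective ⇑(1 - L0) := by
      rw [← LinearMap.ker_eq_bot, LinearMap.ker_eq_bot']
      intro V hV
      exact hinj V (sub_eq_zero.1 hV)
    exact ⟨hi, LinearMap.injective_iff_surjective.1 hi⟩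
  have hp : ∀ t : ℝ, Function.Bijective ⇑(1 - (LinearMap.toContinuousLinearMap L0
        + t • LinearMap.toContinuousLinearMap L1 + t ^ 2 • LinearMap.toContinuousLinearMap L2)) →
      IsLyap Pr A B Q R (K + t • E) (PK Pr A B Q R (K + t • E)) := by
    intro t ht
    have hex : ∃ P, IsLyap Pr A B Q R (K + t • E) P := by
      obtain ⟨P, hP⟩ := ht.2 (fun i => Q i + ((K + t • E) i)ᵀ * R i * (K + t • E) i)
      refine ⟨P, ?_⟩
      rw [isLyap_iff, opLL_expand]
      exact sub_eq_iff_eq_add.1 hP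
    rw [PK, dif_pos hex]
    exact hex.choose_spec
  have hzero : K + (0:ℝ) • E = K := by rw [zero_smul, add_zero]
  obtain ⟨P1, P2, h1, h2, h3⟩ := abstract_second (LinearMap.toContinuousLinearMap L0)
    (LinearMap.toContinuousLinearMap L1) (LinearMap.toContinuousLinearMap L2)
    (fun i => Q i + (K i)ᵀ * R i * K i)
    (fun i => (E i)ᵀ * R i * K i + (K i)ᵀ * R i * E i)
    (fun i => (E i)ᵀ * R i * E i) (LinearMap.toContinuousLinearMap φ)
    (fun t => PK Pr A B Q R (K + t • E)) hu (by
      intro t ht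
      have h := hp t ht
      rw [isLyap_iff, opLL_expand, W_expand] at h
      exact h)
  simp only [hzero] at h1 h2
  refine ⟨?_, P1, P2, h1, h2, h3⟩
  have := hp 0 (by simpa using hu)
  rwa [hzero] at this

lemma final {d k N : ℕ} (A : Fin N → Matrix (Fin d) (Fin d) ℝ) (B : Fin N → Matrix (Fin d) (Fin k) ℝ)
    (Pr : Matrix (Fin N) (Fin N) ℝ) (piv : Fin N → ℝ)
    (Sg : Matrix (Fin d) (Fin d) ℝ) (hSg : Sgᵀ = Sg)
    (Q : Fin N → Matrix (Fin d) (Fin d) ℝ) (hQ : ∀ i, (Q i)ᵀ = Q i)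
    (R : Fin N → Matrix (Fin k) (Fin k) ℝ) (hR : ∀ i, (R i)ᵀ = R i)
    (K : Fin N → Matrix (Fin k) (Fin d) ℝ) (hK : MSS Pr A B K)
    (E : Fin N → Matrix (Fin k) (Fin d) ℝ) :
    deriv (deriv fun t : ℝ => cost Pr A B Q R piv Sg (K + t • E)) 0
      = 2 * ∑ i, (XK Pr piv Sg (Gam A B K) i * (E i)ᵀ
            * (R i + (B i)ᵀ * opE Pr (PK Pr A B Q R K) i * B i) * E i).trace
        - 4 * ∑ i, (XK Pr piv Sg (Gam A B K) i * (E i)ᵀ * (B i)ᵀ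
            * opE Pr (PKd Pr (Gam A B K) (LK Pr A B Q R K) E) i * Gam A B K i).trace := by
  have hsL : ∀ V, Summable fun t : ℕ => (opLL Pr (Gam A B K) (Gam A B K))^[t] V :=
    summable_opL Pr (Gam A B K) hK
  have hsT : ∀ V, Summable fun t : ℕ => (opTl Pr (Gam A B K))^[t] V :=
    summable_opT Pr (Gam A B K) hK
  obtain ⟨hP, P1, P2, h1, h2, h3⟩ := main_aux Pr A B Q R piv Sg K E (neumann_inj _ hsL)
  rw [h3]
  clear h3
  set P := PK Pr A B Q R K with hPdef
  set Γ := Gam A B K with hΓ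
  set L0 := opLL Pr Γ Γ with hL0
  have hcL : Continuous L0 := LinearMap.continuous_of_finiteDimensional _
  have hcT : Continuous (opTl Pr Γ) := LinearMap.continuous_of_finiteDimensional _
  rw [isLyap_iff] at hP
  have hLt : ∀ V : Fin N → Matrix (Fin d) (Fin d) ℝ,
      (fun i => (L0 V i)ᵀ) = L0 (fun i => (V i)ᵀ) := by
    intro V
    funext i
    simp only [hL0, opLL_apply, Matrix.transpose_mul, Matrix.transpose_transpose, opE_transpose,
      Matrix.mul_assoc]
  have hPt : (fun i => (P i)ᵀ) = P := by
    refine neumann_unique L0 hsL _ _ _ ?_ hP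
    rw [← hLt]
    funext i
    have := congrFun hP i
    rw [Pi.add_apply] at this
    conv_lhs => rw [this]
    rw [Pi.add_apply]
    simp [hQ, hR, Matrix.mul_assoc, hL0, hΓ]
  have hEPt : ∀ i, (opE Pr P i)ᵀ = opE Pr P i := by
    intro i; rw [opE_transpose, hPt]
  set U : Fin N → Matrix (Fin d) (Fin d) ℝ :=
    fun i => (E i)ᵀ * LK Pr A B Q R K i + (LK Pr A B Q R K i)ᵀ * E i with hU
  have hLK : ∀ i, LK Pr A B Q R K i = R i * K i - (B i)ᵀ * opE Pr P i * Γ i := by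
    intro i
    simp only [LK, ← hPdef, hΓ, Gam, Matrix.add_mul, Matrix.mul_sub, Matrix.mul_assoc]
    abel
  have hU1 : (fun i => (E i)ᵀ * R i * K i + (K i)ᵀ * R i * E i)
        + (-(opLL Pr (fun i => B i * E i) Γ
          + opLL Pr Γ (fun i => B i * E i))) P = U := by
    funext i
    simp only [hU, hLK, Pi.add_apply, LinearMap.neg_apply, Pi.neg_apply, LinearMap.add_apply,
      opLL_apply, Matrix.transpose_sub, Matrix.transpose_mul, hEPt, hR, Matrix.transpose_transpose,
      Matrix.mul_sub, Matrix.sub_mul, Matrix.mul_assoc]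
    abel
  rw [hU1] at h1
  have hPd : PKd Pr Γ (LK Pr A B Q R K) E = P1 := by
    refine neumann_unique L0 hsL U _ _ ?_ h1
    exact neumann_fix L0 hcL hsL U
  rw [hPd]
  have hP1t : (fun i => (P1 i)ᵀ) = P1 := by
    refine neumann_unique L0 hsL U _ _ ?_ h1
    rw [← hLt]
    funext i
    have := congrFun h1 i
    rw [Pi.add_apply] at this
    conv_lhs => rw [this]
    rw [Pi.add_apply]
    simp [hU, add_comm]
  have hEP1t : ∀ i, (opE Pr P1 i)ᵀ = opE Pr P1 i := by
    intro i; rw [opE_transpose, hP1t]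
  set X := XK Pr piv Sg Γ with hX
  have hXf : X = (fun i => piv i • Sg) + opTl Pr Γ X := neumann_fix (opTl Pr Γ) hcT hsT _
  have hXt' : (fun i => (X i)ᵀ) = X := by
    refine neumann_unique (opTl Pr Γ) hsT _ _ _ ?_ hXf
    funext i
    have := congrFun hXf i
    rw [Pi.add_apply] at this
    conv_lhs => rw [this]
    rw [Pi.add_apply]
    simp [hSg, opTl, opT, Matrix.transpose_sum, Matrix.mul_assoc]
  have hXt : ∀ i, (X i)ᵀ = X i := fun i => congrFun hXt' i
  have hdual : ∑ i, piv i * (P2 i * Sg).trace = ∑ i, ((P2 - L0 P2) i * X i).trace := by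
    have e1 : ∑ i, (L0 P2 i * X i).trace = ∑ i, (P2 i * opTl Pr Γ X i).trace := ip_adj Pr Γ P2 X
    have e2 : ∀ i, piv i * (P2 i * Sg).trace
        = (P2 i * X i).trace - (P2 i * opTl Pr Γ X i).trace := by
      intro i
      have := congrFun hXf i
      rw [Pi.add_apply] at this
      conv_rhs => enter [1]; rw [this]
      simp [Matrix.mul_add]
    simp only [e2, Pi.sub_apply, Matrix.sub_mul, Matrix.trace_sub, Finset.sum_sub_distrib, e1]
  rw [hdual, sub_eq_of_eq_add h2, Finset.mul_sum, Finset.mul_sum, ← Finset.sum_sub_distrib]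
  refine Finset.sum_congr rfl fun i _ => ?_
  have t1 : ((Γ i)ᵀ * opE Pr P1 i * (B i * E i) * X i).trace
      = (X i * (E i)ᵀ * (B i)ᵀ * opE Pr P1 i * Γ i).trace := by
    rw [← Matrix.trace_transpose]
    simp only [Matrix.transpose_mul, Matrix.transpose_transpose, hXt, hEP1t, Matrix.mul_assoc]
  have t2 : ∀ M : Matrix (Fin d) (Fin d) ℝ, (M * X i).trace = (X i * M).trace :=
    fun M => Matrix.trace_mul_comm _ _
  simp only [Pi.add_apply, Pi.smul_apply, LinearMap.neg_apply, Pi.neg_apply, LinearMap.add_apply,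
    opLL_apply, Matrix.add_mul, Matrix.smul_mul, Matrix.neg_mul, Matrix.trace_add,
    Matrix.trace_smul, Matrix.trace_neg, smul_eq_mul, t1, Matrix.mul_add]
  rw [t2, t2, t2]
  simp only [Matrix.transpose_mul, Matrix.mul_assoc]
  ring


/-- the Hessian (second directional derivative) formula. -/
theorem hessian_formula
    (d k N : ℕ) (hd : 0 < d) (hk : 0 < k) (hN : 0 < N)
    (A : Fin N → Matrix (Fin d) (Fin d) ℝ) (B : Fin N → Matrix (Fin d) (Fin k) ℝ)
    (Pr : Matrix (Fin N) (Fin N) ℝ)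
    (hPr : ∀ i j, 0 ≤ Pr i j) (hPrSum : ∀ i, ∑ j, Pr i j = 1)
    (piv : Fin N → ℝ) (hpiv : ∀ i, 0 < piv i) (hpivSum : ∑ i, piv i = 1)
    (Sg : Matrix (Fin d) (Fin d) ℝ) (hSg : Sg.PosDef)
    (Q : Fin N → Matrix (Fin d) (Fin d) ℝ) (hQ : ∀ i, (Q i).PosDef)
    (R : Fin N → Matrix (Fin k) (Fin k) ℝ) (hR : ∀ i, (R i).PosDef)
    (K : Fin N → Matrix (Fin k) (Fin d) ℝ) (hK : MSS Pr A B K)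
    (E : Fin N → Matrix (Fin k) (Fin d) ℝ) :
    deriv (deriv fun t : ℝ => cost Pr A B Q R piv Sg (K + t • E)) 0
      = 2 * ∑ i, (XK Pr piv Sg (Gam A B K) i * (E i)ᵀ
            * (R i + (B i)ᵀ * opE Pr (PK Pr A B Q R K) i * B i) * E i).trace
        - 4 * ∑ i, (XK Pr piv Sg (Gam A B K) i * (E i)ᵀ * (B i)ᵀ
            * opE Pr (PKd Pr (Gam A B K) (LK Pr A B Q R K) E) i * Gam A B K i).trace := by
  have tr : ∀ {n : ℕ} {M : Matrix (Fin n) (Fin n) ℝ}, M.PosDef → Mᵀ = M := fun h => by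
    simpa [Matrix.IsHermitian] using h.isHermitian
  exact final A B Pr piv Sg (tr hSg) Q (fun i => tr (hQ i)) R (fun i => tr (hR i)) K hK E

end MJLS
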